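/- arXiv:1810.02077 — 2 statements merged into one kernel-verified Lean document; each statement's English description precedes it below -/
import Mathlib

section
/- For each minimal exponent v = (i_v,j_v,k_v) set s_v := i_v + (j_v+1)·μ1 + (k_v+1)·μ2 − d, and suppose that for each such v and each integer 0 ≤ t ≤ s_v a polynomial Ψ^t_v ∈ K[T0,T1,X_0,…,X_{μ1},Y_0,…,Y_{μ2}] is given which is homogeneous of degree i_v in the variables T0,T1, homogeneous of degree j_v + k_v + 1 in the variables X_0,…,X_{μ1},Y_0,…,Y_{μ2} taken together, and satisfies Φ'(Ψ^t_v) = T0^t·T1^{s_v−t}·X^{j_v}·Y^{k_v}·(α·Y − β·X). Let G be the set of binomials T1·X_{i−1} − T0·X_i (1 ≤ i ≤ μ1), T1·Y_{j−1} − T0·Y_j (1 ≤ j ≤ μ2), X_i·X_j − X_{i−1}·X_{j+1} (1 ≤ i ≤ j ≤ μ1−1), Y_i·Y_j − Y_{i−1}·Y_{j+1} (1 ≤ i ≤ j ≤ μ2−1), X_i·Y_j − X_{i−1}·Y_{j+1} (1 ≤ i ≤ μ1, 0 ≤ j ≤ μ2−1). Then the kernel of Φ equals the ideal generated by G together with all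 the Ψ^t_v, and this generating set is minimal: none of its elements lies in the ideal generated by the remaining ones. -/
open MvPolynomial

noncomputable section

/-- The polynomial ring `K[T0,T1]`. -/
abbrev PT (K : Type) [Field K] := MvPolynomial (Fin 2) K

/-- The polynomial ring `K[T0,T1,X,Y]`; `Sum.inr 0 = X`, `Sum.inr 1 = Y`. -/
abbrev PTXY (K : Type) [Field K] := MvPolynomial (Fin 2 ⊕ Fin 2) K

/-- The polynomial ring `K[T0,T1,s]`; `Sum.inr () = s`. -/
abbrev PTs (K : Type) [Field K] := MvPolynomial (Fin 2 ⊕ Unit) K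

/-- The polynomial ring `K[T0,T1,X_0,…,X_{μ1},Y_0,…,Y_{μ2}]`. -/
abbrev PBig (K : Type) [Field K] (μ1 μ2 : ℕ) :=
  MvPolynomial (Fin 2 ⊕ (Fin (μ1+1) ⊕ Fin (μ2+1))) K

/-- The map `Φ`. -/
def PhiMap (K : Type) [Field K] (μ1 μ2 : ℕ) (α β : PT K) :
    PBig K μ1 μ2 →ₐ[K] PTs K :=
  aeval (Sum.elim (fun i => X (Sum.inl i))
    (Sum.elim
      (fun i => rename Sum.inl α * X (Sum.inl 0) ^ (μ1 - (i : ℕ)) *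
        X (Sum.inl 1) ^ (i : ℕ) * X (Sum.inr ()))
      (fun i => rename Sum.inl β * X (Sum.inl 0) ^ (μ2 - (i : ℕ)) *
        X (Sum.inl 1) ^ (i : ℕ) * X (Sum.inr ()))))

/-- The map `Φ'`. -/
def Phi'Map (K : Type) [Field K] (μ1 μ2 : ℕ) :
    PBig K μ1 μ2 →ₐ[K] PTXY K :=
  aeval (Sum.elim (fun i => X (Sum.inl i))
    (Sum.elim
      (fun i => X (Sum.inl 0) ^ (μ1 - (i : ℕ)) * X (Sum.inl 1) ^ (i : ℕ) * X (Sum.inr 0))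
      (fun i => X (Sum.inl 0) ^ (μ2 - (i : ℕ)) * X (Sum.inl 1) ^ (i : ℕ) * X (Sum.inr 1))))

/-- Weight function giving degree in the variables `T0,T1`. -/
def wT (μ1 μ2 : ℕ) : Fin 2 ⊕ (Fin (μ1+1) ⊕ Fin (μ2+1)) → ℕ :=
  Sum.elim (fun _ => 1) (fun _ => 0)

/-- Weight function giving degree in the variables `X_0,…,X_{μ1},Y_0,…,Y_{μ2}`
taken together. -/
def wXY (μ1 μ2 : ℕ) : Fin 2 ⊕ (Fin (μ1+1) ⊕ Fin (μ2+1)) → ℕ :=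
  Sum.elim (fun _ => 0) (fun _ => 1)

/-- The variable `X_n` of `PBig` (junk value `0` out of range). -/
def Xn (K : Type) [Field K] (μ1 μ2 : ℕ) (n : ℕ) : PBig K μ1 μ2 :=
  if h : n < μ1 + 1 then X (Sum.inr (Sum.inl ⟨n, h⟩)) else 0

/-- The variable `Y_n` of `PBig` (junk value `0` out of range). -/
def Yn (K : Type) [Field K] (μ1 μ2 : ℕ) (n : ℕ) : PBig K μ1 μ2 :=
  if h : n < μ2 + 1 then X (Sum.inr (Sum.inr ⟨n, h⟩)) else 0

/-- The family `G` of binomial generators: pencils and quadrics. -/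
def genSet (K : Type) [Field K] (μ1 μ2 : ℕ) : Set (PBig K μ1 μ2) :=
  {f | ∃ i : ℕ, 1 ≤ i ∧ i ≤ μ1 ∧
      f = X (Sum.inl 1) * Xn K μ1 μ2 (i-1) - X (Sum.inl 0) * Xn K μ1 μ2 i} ∪
  {f | ∃ j : ℕ, 1 ≤ j ∧ j ≤ μ2 ∧
      f = X (Sum.inl 1) * Yn K μ1 μ2 (j-1) - X (Sum.inl 0) * Yn K μ1 μ2 j} ∪
  {f | ∃ i j : ℕ, 1 ≤ i ∧ i ≤ j ∧ j + 1 ≤ μ1 ∧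
      f = Xn K μ1 μ2 i * Xn K μ1 μ2 j - Xn K μ1 μ2 (i-1) * Xn K μ1 μ2 (j+1)} ∪
  {f | ∃ i j : ℕ, 1 ≤ i ∧ i ≤ j ∧ j + 1 ≤ μ2 ∧
      f = Yn K μ1 μ2 i * Yn K μ1 μ2 j - Yn K μ1 μ2 (i-1) * Yn K μ1 μ2 (j+1)} ∪
  {f | ∃ i j : ℕ, 1 ≤ i ∧ i ≤ μ1 ∧ j + 1 ≤ μ2 ∧
      f = Xn K μ1 μ2 i * Yn K μ1 μ2 j - Xn K μ1 μ2 (i-1) * Yn K μ1 μ2 (j+1)}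

/-- `(i,j,k)` is a minimal exponent of the monomial ideal `S_{μ1,μ2,d}`. -/
def MinExp (d μ1 μ2 : ℕ) (i j k : ℕ) : Prop :=
  d - (μ1 + μ2) ≤ i + μ1 * j + μ2 * k ∧
  (1 ≤ i → ¬ (d - (μ1 + μ2) ≤ (i - 1) + μ1 * j + μ2 * k)) ∧
  (1 ≤ j → ¬ (d - (μ1 + μ2) ≤ i + μ1 * (j - 1) + μ2 * k)) ∧
  (1 ≤ k → ¬ (d - (μ1 + μ2) ≤ i + μ1 * j + μ2 * (k - 1)))

/-- `s_v = i + (j+1)·μ1 + (k+1)·μ2 − d`. -/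
def sval (d μ1 μ2 : ℕ) (i j k : ℕ) : ℕ := i + (j+1) * μ1 + (k+1) * μ2 - d

theorem prod_map_eq_of_exchange {V S B : Type*} [CommMonoid B] (tp : V → S) (lev : V → ℕ)
    (x : V → B) (inj : ∀ u v, tp u = tp v → lev u = lev v → u = v)
    (down : ∀ u l, l ≤ lev u → ∃ u', tp u' = tp u ∧ lev u' = l)
    (exch : ∀ u u' v v', tp u' = tp u → tp v' = tp v → lev u' = lev u + 1 →
      lev v' = lev v + 1 → x u' * x v = x u * x v') (M : Multiset V) :
    ∀ M' : Multiset V, M.map tp = M'.map tp → (M.map lev).sum = (M'.map lev).sum →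
      (M.map x).prod = (M'.map x).prod := by
  classical
  suffices H : ∀ n, ∀ M M' : Multiset V, M.card = n → M.map tp = M'.map tp →
      (M.map lev).sum = (M'.map lev).sum → (M.map x).prod = (M'.map x).prod from
    fun M' => H _ M M' rfl
  intro n
  induction n with
  | zero =>
    intro M M' h0 h1 _
    have h2 := congrArg Multiset.card h1
    simp only [Multiset.card_map, h0] at h2
    rw [Multiset.card_eq_zero.mp h0, Multiset.card_eq_zero.mp h2.symm]
  | succ n ih =>
    have step : ∀ k u u' (N N' : Multiset V), Multiset.card N = n → tp u = tp u' → N.map tp = N'.map tp →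
        lev u' = lev u + k → (N.map lev).sum = (N'.map lev).sum + k →
        x u * (N.map x).prod = x u' * (N'.map x).prod := by
      intro k
      induction k with
      | zero =>
        intro u u' N N' hN ht hNt hl hs
        rw [inj u u' ht hl.symm, ih N N' hN hNt hs]
      | succ k ihk =>
        intro u u' N N' hN ht hNt hl hs
        obtain ⟨v', hv', hv'1⟩ : ∃ v' ∈ N, 1 ≤ lev v' := by
          by_contra! hcon
          have : (N.map lev).sum = 0 := by
            rw [Multiset.sum_eq_zero_iff]
            intro y hy
            obtain ⟨v, hv, rfl⟩ := Multiset.mem_map.mp hy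
            have := hcon v hv
            omega
          omega
        obtain ⟨N0, rfl⟩ := Multiset.exists_cons_of_mem hv'
        obtain ⟨v, hvt, hvl⟩ := down v' (lev v' - 1) (by omega)
        obtain ⟨u1, hut, hul⟩ := down u' (lev u + 1) (by omega)
        have e := exch u u1 v v' (hut.trans ht.symm) hvt.symm hul (by omega)
        have := ihk u1 u' (v ::ₘ N0) N' (by simpa using hN) hut
          (by simpa [hvt] using hNt) (by omega)
          (by simp only [Multiset.map_cons, Multiset.sum_cons] at hs ⊢; omega)
        rw [← this]
        simp only [Multiset.map_cons, Multiset.prod_cons, ← mul_assoc, e]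
    intro M M' h0 h1 h2
    obtain ⟨u, N, rfl⟩ : ∃ u N, M = u ::ₘ N := by
      obtain ⟨u, hu⟩ := Multiset.card_pos_iff_exists_mem.mp (by omega : 0 < M.card)
      exact ⟨u, Multiset.exists_cons_of_mem hu⟩
    have h3 := h1.symm
    rw [Multiset.map_cons, ← Multiset.map_eq_cons] at h3
    obtain ⟨u', hu', ht, hN⟩ := h3
    obtain ⟨N', rfl⟩ := Multiset.exists_cons_of_mem hu'
    rw [Multiset.erase_cons_head] at hN
    simp only [Multiset.card_cons, Multiset.map_cons, Multiset.sum_cons,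
      Multiset.prod_cons] at h0 h2 ⊢
    have hc := congrArg Multiset.card hN
    simp only [Multiset.card_map] at hc
    rcases le_total (lev u) (lev u') with h | h
    · exact step (lev u' - lev u) u u' N N' (by omega) ht.symm hN.symm (by omega) (by omega)
    · exact (step (lev u - lev u') u' u N' N (by omega) ht hN (by omega) (by omega)).symm

/-- The kind of a variable: `0` for the `T`'s, `1` for the `X`'s and `2` for the `Y`'s. -/
def varKind (μ1 μ2 : ℕ) : Fin 2 ⊕ (Fin (μ1+1) ⊕ Fin (μ2+1)) → ℕ :=
  Sum.elim (fun _ => 0) (Sum.elim (fun _ => 1) (fun _ => 2))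

/-- The subscript of a variable. -/
def varIndex (μ1 μ2 : ℕ) : Fin 2 ⊕ (Fin (μ1+1) ⊕ Fin (μ2+1)) → ℕ :=
  Sum.elim (fun i => i) (Sum.elim (fun i => i) (fun i => i))

theorem var_ext {μ1 μ2 : ℕ} (u v : Fin 2 ⊕ (Fin (μ1+1) ⊕ Fin (μ2+1)))
    (h : varKind μ1 μ2 u = varKind μ1 μ2 v) (h' : varIndex μ1 μ2 u = varIndex μ1 μ2 v) :
    u = v := by
  rcases u with u | u | u <;> rcases v with v | v | v <;>
    simp_all [varKind, varIndex, Fin.ext_iff]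

theorem exists_var_index_le {μ1 μ2 : ℕ} (u : Fin 2 ⊕ (Fin (μ1+1) ⊕ Fin (μ2+1))) (l : ℕ)
    (hl : l ≤ varIndex μ1 μ2 u) :
    ∃ u', varKind μ1 μ2 u' = varKind μ1 μ2 u ∧ varIndex μ1 μ2 u' = l := by
  rcases u with u | u | u <;> simp only [varIndex, Sum.elim_inl, Sum.elim_inr] at hl
  · exact ⟨Sum.inl ⟨l, by omega⟩, rfl, rfl⟩
  · exact ⟨Sum.inr (Sum.inl ⟨l, by omega⟩), rfl, rfl⟩
  · exact ⟨Sum.inr (Sum.inr ⟨l, by omega⟩), rfl, rfl⟩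

theorem Xn_of_le {K : Type} [Field K] {μ1 μ2 n : ℕ} (h : n < μ1 + 1) :
    Xn K μ1 μ2 n = X (Sum.inr (Sum.inl ⟨n, h⟩)) := dif_pos h

theorem Yn_of_le {K : Type} [Field K] {μ1 μ2 n : ℕ} (h : n < μ2 + 1) :
    Yn K μ1 μ2 n = X (Sum.inr (Sum.inr ⟨n, h⟩)) := dif_pos h

/-- The generators in `genSet` are the maximal minors of the scroll matrix whose columns are the
pairs of variables of the same kind with consecutive subscripts. -/
theorem mem_genSet_iff {K : Type} [Field K] {μ1 μ2 : ℕ} {g : PBig K μ1 μ2} :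
    g ∈ genSet K μ1 μ2 ↔ ∃ u u' v v', varKind μ1 μ2 u' = varKind μ1 μ2 u ∧
      varKind μ1 μ2 v' = varKind μ1 μ2 v ∧ varIndex μ1 μ2 u' = varIndex μ1 μ2 u + 1 ∧
      varIndex μ1 μ2 v' = varIndex μ1 μ2 v + 1 ∧
      (varKind μ1 μ2 u < varKind μ1 μ2 v ∨
        varKind μ1 μ2 u = varKind μ1 μ2 v ∧ varIndex μ1 μ2 u < varIndex μ1 μ2 v) ∧
      g = X u' * X v - X u * X v' := by
  constructor
  · rintro ((((⟨i, h1, h2, rfl⟩ | ⟨i, h1, h2, rfl⟩) | ⟨i, j, h1, h2, h3, rfl⟩) |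
      ⟨i, j, h1, h2, h3, rfl⟩) | ⟨i, j, h1, h2, h3, rfl⟩)
    · rw [Xn_of_le (by omega), Xn_of_le (by omega)]
      refine ⟨Sum.inl 0, Sum.inl 1,
        Sum.inr (Sum.inl ⟨i - 1, by omega⟩), Sum.inr (Sum.inl ⟨i, by omega⟩),
        rfl, rfl, ?_, ?_, ?_, rfl⟩ <;> simp [varKind, varIndex]
      omega
    · rw [Yn_of_le (by omega), Yn_of_le (by omega)]
      refine ⟨Sum.inl 0, Sum.inl 1,
        Sum.inr (Sum.inr ⟨i - 1, by omega⟩), Sum.inr (Sum.inr ⟨i, by omega⟩),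
        rfl, rfl, ?_, ?_, ?_, rfl⟩ <;> simp [varKind, varIndex]
      omega
    · rw [Xn_of_le (by omega), Xn_of_le (by omega), Xn_of_le (by omega), Xn_of_le (by omega)]
      refine ⟨Sum.inr (Sum.inl ⟨i - 1, by omega⟩), Sum.inr (Sum.inl ⟨i, by omega⟩),
        Sum.inr (Sum.inl ⟨j, by omega⟩), Sum.inr (Sum.inl ⟨j + 1, by omega⟩),
        rfl, rfl, ?_, ?_, ?_, rfl⟩ <;> simp [varKind, varIndex] <;> omega
    · rw [Yn_of_le (by omega), Yn_of_le (by omega), Yn_of_le (by omega), Yn_of_le (by omega)]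
      refine ⟨Sum.inr (Sum.inr ⟨i - 1, by omega⟩), Sum.inr (Sum.inr ⟨i, by omega⟩),
        Sum.inr (Sum.inr ⟨j, by omega⟩), Sum.inr (Sum.inr ⟨j + 1, by omega⟩),
        rfl, rfl, ?_, ?_, ?_, rfl⟩ <;> simp [varKind, varIndex] <;> omega
    · rw [Xn_of_le (by omega), Yn_of_le (by omega), Xn_of_le (by omega), Yn_of_le (by omega)]
      refine ⟨Sum.inr (Sum.inl ⟨i - 1, by omega⟩), Sum.inr (Sum.inl ⟨i, by omega⟩),
        Sum.inr (Sum.inr ⟨j, by omega⟩), Sum.inr (Sum.inr ⟨j + 1, by omega⟩),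
        rfl, rfl, ?_, ?_, ?_, rfl⟩ <;> simp [varKind, varIndex]
      omega
  · rintro ⟨u, u', v, v', h1, h2, h3, h4, h5, rfl⟩
    rcases u with u | u | u <;> rcases u' with u' | u' | u' <;> rcases v with v | v | v <;>
      rcases v' with v' | v' | v' <;> simp [varKind, varIndex] at h1 h2 h3 h4 h5
    · omega
    · obtain rfl : u = 0 := by omega
      obtain rfl : u' = 1 := by omega
      refine Or.inl (Or.inl (Or.inl (Or.inl ⟨v', by omega, by omega, ?_⟩)))
      rw [Xn_of_le (by omega), Xn_of_le (by omega)]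
      simp [h4]
      exact Fin.ext h4
    · obtain rfl : u = 0 := by omega
      obtain rfl : u' = 1 := by omega
      refine Or.inl (Or.inl (Or.inl (Or.inr ⟨v', by omega, by omega, ?_⟩)))
      rw [Yn_of_le (by omega), Yn_of_le (by omega)]
      simp [h4]
      exact Fin.ext h4
    · refine Or.inl (Or.inl (Or.inr ⟨u', v, by omega, by omega, by omega, ?_⟩))
      rw [Xn_of_le (by omega), Xn_of_le (by omega), Xn_of_le (by omega), Xn_of_le (by omega)]
      simp [h3, ← h4]
      exact Fin.ext h3
    · refine Or.inr ⟨u', v, by omega, by omega, by omega, ?_⟩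
      rw [Xn_of_le (by omega), Xn_of_le (by omega), Yn_of_le (by omega), Yn_of_le (by omega)]
      simp [h3, ← h4]
      exact Fin.ext h3
    · refine Or.inl (Or.inr ⟨u', v, by omega, by omega, by omega, ?_⟩)
      rw [Yn_of_le (by omega), Yn_of_le (by omega), Yn_of_le (by omega), Yn_of_le (by omega)]
      simp [h3, ← h4]
      exact Fin.ext h3

/-- The exchange relations modulo the ideal generated by `genSet`. -/
theorem mk_mul_mk_eq_of_genSet {K : Type} [Field K] {μ1 μ2 : ℕ}
    (u u' v v' : Fin 2 ⊕ (Fin (μ1+1) ⊕ Fin (μ2+1)))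
    (h1 : varKind μ1 μ2 u' = varKind μ1 μ2 u) (h2 : varKind μ1 μ2 v' = varKind μ1 μ2 v)
    (h3 : varIndex μ1 μ2 u' = varIndex μ1 μ2 u + 1)
    (h4 : varIndex μ1 μ2 v' = varIndex μ1 μ2 v + 1) :
    Ideal.Quotient.mk (Ideal.span (genSet K μ1 μ2)) (X u') *
        Ideal.Quotient.mk (Ideal.span (genSet K μ1 μ2)) (X v) =
      Ideal.Quotient.mk (Ideal.span (genSet K μ1 μ2)) (X u) *
        Ideal.Quotient.mk (Ideal.span (genSet K μ1 μ2)) (X v') := by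
  have key : ∀ u u' v v', varKind μ1 μ2 u' = varKind μ1 μ2 u →
      varKind μ1 μ2 v' = varKind μ1 μ2 v → varIndex μ1 μ2 u' = varIndex μ1 μ2 u + 1 →
      varIndex μ1 μ2 v' = varIndex μ1 μ2 v + 1 →
      (varKind μ1 μ2 u < varKind μ1 μ2 v ∨
        varKind μ1 μ2 u = varKind μ1 μ2 v ∧ varIndex μ1 μ2 u < varIndex μ1 μ2 v) →
      Ideal.Quotient.mk (Ideal.span (genSet K μ1 μ2)) (X u' * X v) =
        Ideal.Quotient.mk (Ideal.span (genSet K μ1 μ2)) (X u * X v') := by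
    intro u u' v v' h1 h2 h3 h4 h5
    exact Ideal.Quotient.eq.mpr
      (Ideal.subset_span (mem_genSet_iff.mpr ⟨u, u', v, v', h1, h2, h3, h4, h5, rfl⟩))
  rw [← map_mul, ← map_mul]
  by_cases hlt : varKind μ1 μ2 u < varKind μ1 μ2 v ∨
      varKind μ1 μ2 u = varKind μ1 μ2 v ∧ varIndex μ1 μ2 u < varIndex μ1 μ2 v
  · exact key u u' v v' h1 h2 h3 h4 hlt
  by_cases hgt : varKind μ1 μ2 v < varKind μ1 μ2 u ∨
      varKind μ1 μ2 v = varKind μ1 μ2 u ∧ varIndex μ1 μ2 v < varIndex μ1 μ2 u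
  · rw [mul_comm (X u'), mul_comm (X u)]
    exact (key v v' u u' h2 h1 h4 h3 hgt).symm
  · obtain rfl := var_ext u v (by omega) (by omega)
    obtain rfl := var_ext u' v' (by omega) (by omega)
    rw [mul_comm]

/-- The exponent of `T0^a T1^b X^j Y^k`. -/
def expTXY (a b j k : ℕ) : Fin 2 ⊕ Fin 2 →₀ ℕ :=
  Finsupp.single (Sum.inl 0) a + Finsupp.single (Sum.inl 1) b + Finsupp.single (Sum.inr 0) j +
    Finsupp.single (Sum.inr 1) k

theorem monomial_expTXY {K : Type} [Field K] (a b j k : ℕ) :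
    (monomial (expTXY a b j k) 1 : PTXY K) =
      X (Sum.inl 0) ^ a * X (Sum.inl 1) ^ b * X (Sum.inr 0) ^ j * X (Sum.inr 1) ^ k := by
  simp [expTXY, X_pow_eq_monomial, monomial_mul]

@[simp] theorem expTXY_inl_zero (a b j k : ℕ) : expTXY a b j k (Sum.inl 0) = a := by
  simp [expTXY]

@[simp] theorem expTXY_inl_one (a b j k : ℕ) : expTXY a b j k (Sum.inl 1) = b := by
  simp [expTXY]

@[simp] theorem expTXY_inr_zero (a b j k : ℕ) : expTXY a b j k (Sum.inr 0) = j := by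
  simp [expTXY]

@[simp] theorem expTXY_inr_one (a b j k : ℕ) : expTXY a b j k (Sum.inr 1) = k := by
  simp [expTXY]

theorem exp_ext {e e' : Fin 2 ⊕ Fin 2 →₀ ℕ} (h0 : e (Sum.inl 0) = e' (Sum.inl 0))
    (h1 : e (Sum.inl 1) = e' (Sum.inl 1)) (h2 : e (Sum.inr 0) = e' (Sum.inr 0))
    (h3 : e (Sum.inr 1) = e' (Sum.inr 1)) : e = e' := by
  ext i
  rcases i with i | i <;> fin_cases i <;> assumption

/-- The exponent of the monomial to which `Phi'Map` sends a variable. -/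
def varExp (μ1 μ2 : ℕ) : Fin 2 ⊕ (Fin (μ1+1) ⊕ Fin (μ2+1)) → Fin 2 ⊕ Fin 2 →₀ ℕ :=
  Sum.elim (fun i => Finsupp.single (Sum.inl i) 1)
    (Sum.elim (fun i => expTXY (μ1 - i) i 1 0) (fun i => expTXY (μ2 - i) i 0 1))

theorem Phi'Map_X {K : Type} [Field K] {μ1 μ2 : ℕ} (v : Fin 2 ⊕ (Fin (μ1+1) ⊕ Fin (μ2+1))) :
    Phi'Map K μ1 μ2 (X v) = monomial (varExp μ1 μ2 v) 1 := by
  rcases v with v | v | v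
  · rw [Phi'Map, aeval_X]; rfl
  · simp [Phi'Map, varExp, monomial_expTXY]
  · simp [Phi'Map, varExp, monomial_expTXY]

theorem monomial_eq_multiset_prod {K : Type} [Field K] {σ : Type*} (e : σ →₀ ℕ) :
    (monomial e 1 : MvPolynomial σ K) = (e.toMultiset.map X).prod := by
  induction e using Finsupp.induction_linear with
  | zero => simp
  | add e e' h h' =>
    rw [map_add, Multiset.map_add, Multiset.prod_add, ← h, ← h', monomial_mul, one_mul]
  | single v n => simp [Finsupp.toMultiset_single, Multiset.map_nsmul, Multiset.prod_nsmul, X_pow_eq_monomial]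

theorem Phi'Map_monomial {K : Type} [Field K] {μ1 μ2 : ℕ}
    (e : Fin 2 ⊕ (Fin (μ1+1) ⊕ Fin (μ2+1)) →₀ ℕ) :
    Phi'Map K μ1 μ2 (monomial e 1) =
      monomial (e.toMultiset.map (varExp μ1 μ2)).sum 1 := by
  rw [monomial_eq_multiset_prod, map_multiset_prod, Multiset.map_map]
  induction e.toMultiset using Multiset.induction with
  | empty => simp
  | cons v M ih =>
    rw [Multiset.map_cons, Multiset.prod_cons, ih, Multiset.map_cons, Multiset.sum_cons,
      Function.comp_apply, Phi'Map_X, monomial_mul, one_mul]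

theorem sum_varExp {μ1 μ2 : ℕ} (M : Multiset (Fin 2 ⊕ (Fin (μ1+1) ⊕ Fin (μ2+1)))) :
    (M.map (varExp μ1 μ2)).sum (Sum.inl 1) = (M.map (varIndex μ1 μ2)).sum ∧
    (M.map (varExp μ1 μ2)).sum (Sum.inr 0) = (M.map (varKind μ1 μ2)).count 1 ∧
    (M.map (varExp μ1 μ2)).sum (Sum.inr 1) = (M.map (varKind μ1 μ2)).count 2 ∧
    (M.map (varExp μ1 μ2)).sum (Sum.inl 0) + (M.map (varExp μ1 μ2)).sum (Sum.inl 1) =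
      (M.map (varKind μ1 μ2)).count 0 + μ1 * (M.map (varKind μ1 μ2)).count 1 +
        μ2 * (M.map (varKind μ1 μ2)).count 2 := by
  induction M using Multiset.induction with
  | empty => simp
  | cons v M ih =>
    obtain ⟨h1, h2, h3, h4⟩ := ih
    simp only [Multiset.map_cons, Multiset.sum_cons, Finsupp.add_apply, h1, h2, h3,
      Multiset.count_cons]
    rw [h1] at h4
    generalize (M.map (varExp μ1 μ2)).sum = E at *
    generalize (M.map (varIndex μ1 μ2)).sum = l at *
    generalize (M.map (varKind μ1 μ2)) = N at *
    rcases v with v | v | v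
    · fin_cases v <;> simp [varExp, varIndex, varKind] <;> omega
    · have := v.2
      simp [varExp, varIndex, varKind, mul_add]
      omega
    · have := v.2
      simp [varExp, varIndex, varKind, mul_add]
      omega

theorem map_varKind_eq_of_sum_varExp_eq {μ1 μ2 : ℕ}
    {M M' : Multiset (Fin 2 ⊕ (Fin (μ1+1) ⊕ Fin (μ2+1)))}
    (h : (M.map (varExp μ1 μ2)).sum = (M'.map (varExp μ1 μ2)).sum) :
    M.map (varKind μ1 μ2) = M'.map (varKind μ1 μ2) ∧
      (M.map (varIndex μ1 μ2)).sum = (M'.map (varIndex μ1 μ2)).sum := by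
  obtain ⟨h1, h2, h3, h4⟩ := sum_varExp M
  obtain ⟨h1', h2', h3', h4'⟩ := sum_varExp M'
  rw [h] at h1 h2 h3 h4
  have e1 := h2.symm.trans h2'
  have e2 := h3.symm.trans h3'
  have e0 := h4.symm.trans h4'
  rw [e1, e2] at e0
  refine ⟨?_, h1.symm.trans h1'⟩
  have big : ∀ (N : Multiset (Fin 2 ⊕ (Fin (μ1+1) ⊕ Fin (μ2+1)))) (n : ℕ),
      (N.map (varKind μ1 μ2)).count (n + 3) = 0 := by
    intro N n
    rw [Multiset.count_eq_zero, Multiset.mem_map]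
    rintro ⟨v, -, hv⟩
    rcases v with v | v | v <;> simp [varKind] at hv
  ext n
  match n with
  | 0 => omega
  | 1 => exact e1
  | 2 => exact e2
  | n + 3 => rw [big, big]

theorem varExp_add_single {μ1 μ2 : ℕ} {u u' : Fin 2 ⊕ (Fin (μ1+1) ⊕ Fin (μ2+1))}
    (h : varKind μ1 μ2 u' = varKind μ1 μ2 u) (h' : varIndex μ1 μ2 u' = varIndex μ1 μ2 u + 1) :
    varExp μ1 μ2 u' + Finsupp.single (Sum.inl 0) 1 =
      varExp μ1 μ2 u + Finsupp.single (Sum.inl 1) 1 := by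
  rcases u with u | u | u <;> rcases u' with u' | u' | u' <;> simp [varKind] at h <;>
    simp only [varIndex, Sum.elim_inl, Sum.elim_inr] at h'
  · obtain rfl : u = 0 := by omega
    obtain rfl : u' = 1 := by omega
    exact add_comm _ _
  · have := u'.2
    apply exp_ext <;> simp [varExp] <;> omega
  · have := u'.2
    apply exp_ext <;> simp [varExp] <;> omega

theorem Phi'Map_eq_zero_of_mem_genSet {K : Type} [Field K] {μ1 μ2 : ℕ} {g : PBig K μ1 μ2}
    (hg : g ∈ genSet K μ1 μ2) : Phi'Map K μ1 μ2 g = 0 := by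
  obtain ⟨u, u', v, v', h1, h2, h3, h4, -, rfl⟩ := mem_genSet_iff.mp hg
  simp only [map_sub, map_mul, Phi'Map_X, monomial_mul, mul_one, sub_eq_zero]
  refine congrArg (fun e => monomial e (1 : K)) ?_
  have hu := varExp_add_single h1 h3
  have hv := varExp_add_single h2 h4
  refine add_right_cancel (b := Finsupp.single (Sum.inl 0) 1) ?_
  rw [add_right_comm, hu, add_assoc _ (varExp μ1 μ2 v'), hv, add_right_comm, add_assoc]

theorem Phi'Map_ker {K : Type} [Field K] {μ1 μ2 : ℕ} {f : PBig K μ1 μ2}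
    (hf : Phi'Map K μ1 μ2 f = 0) : f ∈ Ideal.span (genSet K μ1 μ2) := by
  classical
  set I := Ideal.span (genSet K μ1 μ2)
  let im : (Fin 2 ⊕ (Fin (μ1+1) ⊕ Fin (μ2+1)) →₀ ℕ) → (Fin 2 ⊕ Fin 2 →₀ ℕ) :=
    fun e => (e.toMultiset.map (varExp μ1 μ2)).sum
  let φ : PTXY K →ₗ[K] PBig K μ1 μ2 ⧸ I := (basisMonomials _ K).constr K fun w =>
    if h : ∃ e, im e = w then Ideal.Quotient.mk I (monomial h.choose 1) else 0
  have hφ : φ ∘ₗ (Phi'Map K μ1 μ2).toLinearMap = (Ideal.Quotient.mkₐ K I).toLinearMap := by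
    refine (basisMonomials _ K).ext fun e => ?_
    have hex : ∃ e', im e' = im e := ⟨e, rfl⟩
    have h1 : φ (monomial (im e) 1) = Ideal.Quotient.mk I (monomial hex.choose 1) := by
      have := (basisMonomials (Fin 2 ⊕ Fin 2) K).constr_basis K (fun w =>
        if h : ∃ e, im e = w then Ideal.Quotient.mk I (monomial h.choose 1) else 0) (im e)
      rw [dif_pos hex, coe_basisMonomials] at this
      exact this
    simp only [coe_basisMonomials, LinearMap.comp_apply, AlgHom.toLinearMap_apply,
      Phi'Map_monomial, Ideal.Quotient.mkₐ_eq_mk]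
    refine h1.trans ?_
    obtain ⟨hk, hi⟩ := map_varKind_eq_of_sum_varExp_eq hex.choose_spec
    have := prod_map_eq_of_exchange (varKind μ1 μ2) (varIndex μ1 μ2)
      (fun v => Ideal.Quotient.mk I (X v)) var_ext exists_var_index_le
      mk_mul_mk_eq_of_genSet _ _ hk hi
    rw [monomial_eq_multiset_prod, monomial_eq_multiset_prod, map_multiset_prod,
      map_multiset_prod, Multiset.map_map, Multiset.map_map]
    exact this
  rw [← Ideal.Quotient.eq_zero_iff_mem]
  have := LinearMap.congr_fun hφ f
  simp only [LinearMap.comp_apply, AlgHom.toLinearMap_apply, hf, map_zero,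
    Ideal.Quotient.mkₐ_eq_mk] at this
  exact this.symm

theorem isRelPrime_C_mul_X_sub {A : Type*} [CommRing A] [IsDomain A] {a b : A} (ha : a ≠ 0)
    (h : IsRelPrime a b) :
    IsRelPrime (C a : MvPolynomial (Fin 2) A) (C a * X 1 - C b * X 0) := by
  intro c h1 h2
  obtain ⟨c, hc, rfl⟩ := (dvd_C_iff_exists ha).mp h1
  refine (h hc ?_).map C
  have := C_dvd_iff_dvd_coeff _ _ |>.mp h2 (Finsupp.single 0 1)
  simpa [coeff_C_mul, coeff_X, Finsupp.single_left_inj] using this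

theorem dvd_of_aeval_C_mul_X_eq_zero {A : Type*} [CommRing A] [IsDomain A]
    [UniqueFactorizationMonoid A] {a b : A} (ha : a ≠ 0) (h : IsRelPrime a b)
    {p : MvPolynomial (Fin 2) A}
    (hp : aeval ![Polynomial.C a * Polynomial.X, Polynomial.C b * Polynomial.X] p = 0) :
    C a * X 1 - C b * X 0 ∣ p := by
  set q : MvPolynomial (Fin 2) A := C a * X 1 - C b * X 0 with hq
  set ψ : MvPolynomial (Fin 2) A →ₐ[A] Polynomial A :=
    aeval ![Polynomial.C a * Polynomial.X, Polynomial.C b * Polynomial.X] with hψ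
  let ρ : Polynomial A →ₐ[A] MvPolynomial (Fin 2) A := Polynomial.aeval (X 0)
  have hψρ : ∀ r, ψ (ρ r) = r.comp (Polynomial.C a * Polynomial.X) := by
    intro r
    rw [← Polynomial.aeval_algHom_apply ψ, Polynomial.comp_eq_aeval]
    simp [hψ]
  have hψq : ψ q = 0 := by
    simp [hψ, hq]
    ring
  have key : ∀ p : MvPolynomial (Fin 2) A, ∃ N r, q ∣ C a ^ N * p - ρ r := by
    intro p
    induction p using MvPolynomial.induction_on with
    | C c => exact ⟨0, Polynomial.C c, by simp [ρ, MvPolynomial.algebraMap_eq]⟩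
    | add p p' hp hp' =>
      obtain ⟨N, r, g, hr⟩ := hp
      obtain ⟨N', r', g', hr'⟩ := hp'
      refine ⟨N + N', Polynomial.C (a ^ N') * r + Polynomial.C (a ^ N) * r',
        C a ^ N' * g + C a ^ N * g', ?_⟩
      simp only [ρ, map_add, map_mul, Polynomial.aeval_C, MvPolynomial.algebraMap_eq, map_pow]
      linear_combination C a ^ N' * hr + C a ^ N * hr'
    | mul_X p i hp =>
      obtain ⟨N, r, g, hr⟩ := hp
      fin_cases i
      · refine ⟨N, r * Polynomial.X, g * X 0, ?_⟩
        simp only [ρ, map_mul, Polynomial.aeval_X, Fin.zero_eta] at hr ⊢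
        linear_combination X 0 * hr
      · refine ⟨N + 1, Polynomial.C b * r * Polynomial.X, C a * X 1 * g + ρ r, ?_⟩
        simp only [ρ, map_mul, Polynomial.aeval_X, Polynomial.aeval_C,
          MvPolynomial.algebraMap_eq, Fin.mk_one] at hr ⊢
        linear_combination C a * X 1 * hr + Polynomial.aeval (X 0) r * hq
  obtain ⟨N, r, g, hr⟩ := key p
  have hr0 : r = 0 := by
    have := congrArg ψ hr
    rw [map_sub, map_mul, map_mul, hψρ, hp, hψq] at this
    refine (Polynomial.comp_C_mul_X_eq_zero_iff (mem_nonZeroDivisors_of_ne_zero ha)).mp ?_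
    simpa using this
  rw [hr0, map_zero, sub_zero] at hr
  have hq0 : IsRelPrime (C a : MvPolynomial (Fin 2) A) q := isRelPrime_C_mul_X_sub ha h
  exact (hq0.pow_left (m := N)).symm.dvd_of_dvd_mul_left ⟨g, hr⟩

/-- The form `α Y - β X`. -/
def syz {K : Type} [Field K] (α β : PT K) : PTXY K :=
  rename Sum.inl α * X (Sum.inr 1) - rename Sum.inl β * X (Sum.inr 0)

theorem PhiMap_eq_zero_iff {K : Type} [Field K] {μ1 μ2 : ℕ} {α β : PT K} (hα : α ≠ 0)
    (h : IsRelPrime α β) (f : PBig K μ1 μ2) :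
    PhiMap K μ1 μ2 α β f = 0 ↔ syz α β ∣ Phi'Map K μ1 μ2 f := by
  constructor
  · intro hf
    let E : PTXY K ≃ₐ[K] MvPolynomial (Fin 2) (PT K) :=
      (renameEquiv K (Equiv.sumComm _ _)).trans (sumAlgEquiv K (Fin 2) (Fin 2))
    have hEl : ∀ i, E (X (Sum.inl i)) = C (X i) := fun i => by simp [E]
    have hEr : ∀ i, E (X (Sum.inr i)) = X i := fun i => by simp [E]
    have hEC : ∀ a : PT K, E (rename Sum.inl a) = C a := fun a => by
      have : (E.toAlgHom.comp (rename Sum.inl)) = (IsScalarTower.toAlgHom K (PT K) _) := by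
        ext i : 1
        simp [hEl, MvPolynomial.algebraMap_eq]
      exact DFunLike.congr_fun this a
    let χ : PTs K →ₐ[K] Polynomial (PT K) :=
      aeval (Sum.elim (fun i => Polynomial.C (X i)) (fun _ => Polynomial.X))
    have hχC : ∀ a : PT K, χ (rename Sum.inl a) = Polynomial.C a := fun a => by
      have : (χ.comp (rename Sum.inl)) = (IsScalarTower.toAlgHom K (PT K) _) := by
        ext i : 1
        simp [χ]
      exact DFunLike.congr_fun this a
    let ψ : MvPolynomial (Fin 2) (PT K) →ₐ[PT K] Polynomial (PT K) :=
      aeval ![Polynomial.C α * Polynomial.X, Polynomial.C β * Polynomial.X]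
    have hcomp : χ.comp (PhiMap K μ1 μ2 α β) =
        ((ψ.restrictScalars K).comp E.toAlgHom).comp (Phi'Map K μ1 μ2) := by
      ext v : 1
      rcases v with v | v | v
      · simp [PhiMap, Phi'Map, χ, hEl, ψ]
      · simp [PhiMap, Phi'Map, hχC, hEl, hEr, ψ]
        simp [χ]
        ring
      · simp [PhiMap, Phi'Map, hχC, hEl, hEr, ψ]
        simp [χ]
        ring
    have h1 : ψ (E (Phi'Map K μ1 μ2 f)) = 0 := by
      have := DFunLike.congr_fun hcomp f
      simp only [AlgHom.comp_apply, hf, map_zero] at this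
      exact this.symm
    have h2 := dvd_of_aeval_C_mul_X_eq_zero hα h h1
    have h3 : E (syz α β) = C α * X 1 - C β * X 0 := by
      simp only [syz, map_sub, map_mul, hEC, hEr]
    rw [← h3] at h2
    exact (map_dvd_iff E).mp h2
  · rintro ⟨g, hg⟩
    let ψ : PTXY K →ₐ[K] PTs K := aeval (Sum.elim (fun i => X (Sum.inl i))
      ![rename Sum.inl α * X (Sum.inr ()), rename Sum.inl β * X (Sum.inr ())])
    have hψC : ∀ a : PT K, ψ (rename Sum.inl a) = rename Sum.inl a := fun a => by
      have : ψ.comp (rename Sum.inl) = rename Sum.inl := by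
        ext i : 1
        simp [ψ]
      exact DFunLike.congr_fun this a
    have hcomp : PhiMap K μ1 μ2 α β = ψ.comp (Phi'Map K μ1 μ2) := by
      ext v : 1
      rcases v with v | v | v
      · simp [PhiMap, Phi'Map, ψ]
      · simp [PhiMap, Phi'Map, ψ]
        ring
      · simp [PhiMap, Phi'Map, ψ]
        ring
    rw [hcomp, AlgHom.comp_apply, hg, map_mul, syz, map_sub, map_mul, map_mul, hψC, hψC]
    simp [ψ]
    left
    ring

theorem mul_le_of_mem_support_Phi'Map {K : Type} [Field K] {μ1 μ2 : ℕ} {f : PBig K μ1 μ2}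
    {e : Fin 2 ⊕ Fin 2 →₀ ℕ} (he : e ∈ (Phi'Map K μ1 μ2 f).support) :
    μ1 * e (Sum.inr 0) + μ2 * e (Sum.inr 1) ≤ e (Sum.inl 0) + e (Sum.inl 1) := by
  classical
  induction f using MvPolynomial.induction_on' with
  | monomial u a =>
    rw [← mul_one a, ← smul_eq_mul, ← smul_monomial, map_smul, Phi'Map_monomial] at he
    obtain rfl := Finset.mem_singleton.mp (support_monomial_subset (support_smul he))
    obtain ⟨-, h2, h3, h4⟩ := sum_varExp (μ1 := μ1) (μ2 := μ2) u.toMultiset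
    rw [h2, h3, h4]
    omega
  | add p p' hp hp' =>
    rw [map_add] at he
    exact (Finset.mem_union.mp (support_add he)).elim hp hp'

theorem exists_Phi'Map_eq_monomial {K : Type} [Field K] {μ1 μ2 : ℕ} (j k : ℕ) :
    ∀ a b : ℕ, μ1 * j + μ2 * k ≤ a + b →
      ∃ f, Phi'Map K μ1 μ2 f = monomial (expTXY a b j k) 1 := by
  induction j with
  | zero =>
    induction k with
    | zero =>
      intro a b _
      refine ⟨X (Sum.inl 0) ^ a * X (Sum.inl 1) ^ b, ?_⟩
      rw [monomial_expTXY]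
      simp [Phi'Map]
    | succ k ih =>
      intro a b hab
      rw [mul_add] at hab
      obtain ⟨f, hf⟩ := ih (a - (μ2 - min b μ2)) (b - min b μ2) (by omega)
      refine ⟨f * X (Sum.inr (Sum.inr ⟨min b μ2, by omega⟩)), ?_⟩
      rw [map_mul, hf, Phi'Map_X, monomial_mul, one_mul]
      refine congrArg (fun e => monomial e (1 : K)) ?_
      apply exp_ext <;> simp [varExp]
      omega
  | succ j ih =>
    intro a b hab
    rw [mul_add] at hab
    obtain ⟨f, hf⟩ := ih (a - (μ1 - min b μ1)) (b - min b μ1) (by omega)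
    refine ⟨f * X (Sum.inr (Sum.inl ⟨min b μ1, by omega⟩)), ?_⟩
    rw [map_mul, hf, Phi'Map_X, monomial_mul, one_mul]
    refine congrArg (fun e => monomial e (1 : K)) ?_
    apply exp_ext <;> simp [varExp]
    omega

theorem weight_of_mem_support_rename {K : Type} [Field K] {α : PT K} {n : ℕ}
    (hα : α.IsHomogeneous n) {e : Fin 2 ⊕ Fin 2 →₀ ℕ}
    (he : e ∈ (rename Sum.inl α : PTXY K).support) :
    e (Sum.inl 0) + e (Sum.inl 1) = n ∧ e (Sum.inr 0) = 0 ∧ e (Sum.inr 1) = 0 := by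
  classical
  rw [support_rename_of_injective Sum.inl_injective] at he
  obtain ⟨e', he', rfl⟩ := Finset.mem_image.mp he
  have h0 : ∀ i, Finsupp.mapDomain (Sum.inl : Fin 2 → Fin 2 ⊕ Fin 2) e' (Sum.inl i) = e' i :=
    fun i => Finsupp.mapDomain_apply Sum.inl_injective e' i
  have h1 : ∀ i, Finsupp.mapDomain (Sum.inl : Fin 2 → Fin 2 ⊕ Fin 2) e' (Sum.inr i) = 0 :=
    fun i => Finsupp.mapDomain_of_notMem_range _ _ (by simp)
  refine ⟨?_, h1 0, h1 1⟩
  have := hα (mem_support_iff.mp he')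
  rw [h0, h0, ← this, Finsupp.weight_apply, Finsupp.sum_fintype _ _ (by simp)]
  simp

theorem weight_of_mem_support_syz {K : Type} [Field K] {d μ1 μ2 : ℕ} (hd : μ1 + μ2 ≤ d)
    {α β : PT K} (hα : α.IsHomogeneous (d - μ1)) (hβ : β.IsHomogeneous (d - μ2))
    {e : Fin 2 ⊕ Fin 2 →₀ ℕ} (he : e ∈ (syz α β).support) :
    e (Sum.inl 0) + e (Sum.inl 1) =
      d - (μ1 + μ2) + (μ1 * e (Sum.inr 0) + μ2 * e (Sum.inr 1)) := by
  classical
  rcases Finset.mem_union.mp (support_sub _ _ _ he) with h | h <;>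
    rw [support_mul_X] at h <;> obtain ⟨e', he', rfl⟩ := Finset.mem_map.mp h
  · obtain ⟨h1, h2, h3⟩ := weight_of_mem_support_rename hα he'
    simp [h1, h2, h3]
    omega
  · obtain ⟨h1, h2, h3⟩ := weight_of_mem_support_rename hβ he'
    simp [h1, h2, h3]
    omega

theorem exists_minExp_le {d μ1 μ2 : ℕ} (n : ℕ) : ∀ i j k : ℕ, i + j + k = n →
    d - (μ1 + μ2) ≤ i + μ1 * j + μ2 * k →
    ∃ i' j' k', i' ≤ i ∧ j' ≤ j ∧ k' ≤ k ∧ MinExp d μ1 μ2 i' j' k' := by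
  induction n with
  | zero =>
    intro i j k hn h
    exact ⟨i, j, k, le_rfl, le_rfl, le_rfl, h, by omega, by omega, by omega⟩
  | succ n ih =>
    intro i j k hn h
    by_cases hm : MinExp d μ1 μ2 i j k
    · exact ⟨i, j, k, le_rfl, le_rfl, le_rfl, hm⟩
    · rw [MinExp] at hm
      push Not at hm
      by_cases h1 : 1 ≤ i ∧ d - (μ1 + μ2) ≤ (i - 1) + μ1 * j + μ2 * k
      · obtain ⟨i', j', k', hi, hj, hk, hm'⟩ := ih (i - 1) j k (by omega) h1.2
        exact ⟨i', j', k', by omega, hj, hk, hm'⟩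
      by_cases h2 : 1 ≤ j ∧ d - (μ1 + μ2) ≤ i + μ1 * (j - 1) + μ2 * k
      · obtain ⟨i', j', k', hi, hj, hk, hm'⟩ := ih i (j - 1) k (by omega) h2.2
        exact ⟨i', j', k', hi, by omega, hk, hm'⟩
      obtain ⟨h3, h4⟩ := hm h (fun a => not_le.mp fun b => h1 ⟨a, b⟩)
        (fun a => not_le.mp fun b => h2 ⟨a, b⟩)
      obtain ⟨i', j', k', hi, hj, hk, hm'⟩ := ih i j (k - 1) (by omega) h4
      exact ⟨i', j', k', hi, hj, by omega, hm'⟩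

/-- The exponent of `T0^t T1^(s - t) X^j Y^k`, where `s = sval d μ1 μ2 i j k`. -/
def psiExp (d μ1 μ2 i j k t : ℕ) : Fin 2 ⊕ Fin 2 →₀ ℕ :=
  expTXY t (sval d μ1 μ2 i j k - t) j k

theorem sval_add {d μ1 μ2 i j k : ℕ} (hd : μ1 + μ2 ≤ d)
    (h : d - (μ1 + μ2) ≤ i + μ1 * j + μ2 * k) :
    sval d μ1 μ2 i j k + (d - (μ1 + μ2)) = i + μ1 * j + μ2 * k := by
  rw [sval, add_mul, add_mul, one_mul, one_mul, mul_comm j, mul_comm k]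
  omega

theorem exists_psiExp_add {d μ1 μ2 : ℕ} (hd : μ1 + μ2 ≤ d) {e : Fin 2 ⊕ Fin 2 →₀ ℕ}
    (he : μ1 * e (Sum.inr 0) + μ2 * e (Sum.inr 1) ≤
      e (Sum.inl 0) + e (Sum.inl 1) + (d - (μ1 + μ2))) :
    ∃ i j k t a b j' k', MinExp d μ1 μ2 i j k ∧ t ≤ sval d μ1 μ2 i j k ∧
      μ1 * j' + μ2 * k' ≤ a + b ∧ e = expTXY a b j' k' + psiExp d μ1 μ2 i j k t := by
  obtain ⟨i', j', k', hi, hj, hk, hm⟩ := exists_minExp_le (d := d) (μ1 := μ1) (μ2 := μ2) _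
    (e (Sum.inl 0) + e (Sum.inl 1) + (d - (μ1 + μ2)) -
      (μ1 * e (Sum.inr 0) + μ2 * e (Sum.inr 1))) (e (Sum.inr 0)) (e (Sum.inr 1)) rfl (by omega)
  have hs := sval_add hd hm.1
  obtain ⟨j, hj⟩ := Nat.exists_eq_add_of_le hj
  obtain ⟨k, hk⟩ := Nat.exists_eq_add_of_le hk
  rw [hj, hk, mul_add, mul_add] at he hi
  refine ⟨i', j', k', min (e (Sum.inl 0)) (sval d μ1 μ2 i' j' k'),
    e (Sum.inl 0) - min (e (Sum.inl 0)) (sval d μ1 μ2 i' j' k'),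
    e (Sum.inl 1) - (sval d μ1 μ2 i' j' k' -
      min (e (Sum.inl 0)) (sval d μ1 μ2 i' j' k')), j, k, hm, min_le_right _ _, by omega, ?_⟩
  apply exp_ext <;> simp [psiExp] <;> omega

theorem exists_mem_Phi'Map_eq {K : Type} [Field K] {d μ1 μ2 : ℕ} (hd : μ1 + μ2 ≤ d) {q : PTXY K}
    {J : Ideal (PBig K μ1 μ2)}
    (hJ : ∀ i j k t, MinExp d μ1 μ2 i j k → t ≤ sval d μ1 μ2 i j k →
      ∃ x ∈ J, Phi'Map K μ1 μ2 x = monomial (psiExp d μ1 μ2 i j k t) 1 * q)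
    {g : PTXY K} (hg : ∀ e ∈ g.support, μ1 * e (Sum.inr 0) + μ2 * e (Sum.inr 1) ≤
      e (Sum.inl 0) + e (Sum.inl 1) + (d - (μ1 + μ2))) :
    ∃ x ∈ J, Phi'Map K μ1 μ2 x = g * q := by
  have hmon : ∀ e ∈ g.support, ∃ x ∈ J, Phi'Map K μ1 μ2 x = monomial e 1 * q := by
    intro e he
    obtain ⟨i, j, k, t, a, b, j', k', hm, ht, hc, rfl⟩ := exists_psiExp_add hd (hg e he)
    obtain ⟨x, hx, hx'⟩ := hJ i j k t hm ht
    obtain ⟨f, hf⟩ := exists_Phi'Map_eq_monomial (K := K) j' k' a b hc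
    refine ⟨f * x, J.mul_mem_left f hx, ?_⟩
    rw [map_mul, hf, hx', ← mul_assoc, monomial_mul, one_mul]
  choose! x hx hx' using hmon
  refine ⟨∑ e ∈ g.support, C (coeff e g) * x e,
    J.sum_mem fun e he => J.mul_mem_left _ (hx e he), ?_⟩
  conv_rhs => rw [g.as_sum]
  rw [map_sum, Finset.sum_mul]
  refine Finset.sum_congr rfl fun e he => ?_
  rw [map_mul, hx' e he, ← MvPolynomial.algebraMap_eq, AlgHom.commutes,
    MvPolynomial.algebraMap_eq, ← mul_assoc, C_mul_monomial, mul_one]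

theorem weight_of_mem_support_of_mul {K : Type} [Field K] {d μ1 μ2 : ℕ}
    {q : PTXY K} (hq0 : q ≠ 0) (hq : ∀ e ∈ q.support, e (Sum.inl 0) + e (Sum.inl 1) =
      d - (μ1 + μ2) + (μ1 * e (Sum.inr 0) + μ2 * e (Sum.inr 1)))
    {g : PTXY K} (hg : ∀ e ∈ (g * q).support,
      μ1 * e (Sum.inr 0) + μ2 * e (Sum.inr 1) ≤ e (Sum.inl 0) + e (Sum.inl 1)) :
    ∀ e ∈ g.support, μ1 * e (Sum.inr 0) + μ2 * e (Sum.inr 1) ≤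
      e (Sum.inl 0) + e (Sum.inl 1) + (d - (μ1 + μ2)) := by
  classical
  let good : (Fin 2 ⊕ Fin 2 →₀ ℕ) → Prop := fun e =>
    μ1 * e (Sum.inr 0) + μ2 * e (Sum.inr 1) ≤ e (Sum.inl 0) + e (Sum.inl 1) + (d - (μ1 + μ2))
  have hsub : ∀ s : Finset (Fin 2 ⊕ Fin 2 →₀ ℕ),
      (∑ e ∈ s, monomial e (coeff e g)).support ⊆ s := by
    intro s e he
    obtain ⟨e', he', h⟩ := Finset.mem_biUnion.mp (support_sum he)
    exact Finset.mem_singleton.mp (support_monomial_subset h) ▸ he'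
  have hsplit : g = ∑ e ∈ g.support with good e, monomial e (coeff e g) +
      ∑ e ∈ g.support with ¬ good e, monomial e (coeff e g) := by
    rw [Finset.sum_filter_add_sum_filter_not]
    exact g.as_sum
  have hs1 := hsub {e ∈ g.support | good e}
  have hs2 := hsub {e ∈ g.support | ¬ good e}
  generalize ∑ e ∈ g.support with good e, monomial e (coeff e g) = g1 at hsplit hs1
  generalize ∑ e ∈ g.support with ¬ good e, monomial e (coeff e g) = g2 at hsplit hs2
  have hg2 : g2 * q = 0 := by
    rw [← support_eq_empty, Finset.eq_empty_iff_forall_notMem]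
    intro e he
    have hbad : e (Sum.inl 0) + e (Sum.inl 1) < μ1 * e (Sum.inr 0) + μ2 * e (Sum.inr 1) := by
      obtain ⟨u, hu, v, hv, rfl⟩ := Finset.mem_add.mp (support_mul _ _ he)
      have h1 := (Finset.mem_filter.mp (hs2 hu)).2
      have h2 := hq v hv
      simp only [good, not_le] at h1
      simp only [Finsupp.add_apply, mul_add]
      omega
    have : g2 * q = g * q - g1 * q := by rw [hsplit]; ring
    rw [this] at he
    rcases Finset.mem_union.mp (support_sub _ _ _ he) with h | h
    · exact absurd (hg e h) (not_le.mpr hbad)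
    · obtain ⟨u, hu, v, hv, rfl⟩ := Finset.mem_add.mp (support_mul _ _ h)
      have h1 := (Finset.mem_filter.mp (hs1 hu)).2
      have h2 := hq v hv
      simp only [good] at h1
      simp only [Finsupp.add_apply, mul_add] at hbad
      omega
  have hg0 : g2 = 0 := (mul_eq_zero.mp hg2).resolve_right hq0
  rw [hg0, add_zero] at hsplit
  intro e he
  rw [hsplit] at he
  exact (Finset.mem_filter.mp (hs1 he)).2

theorem MinExp.eq_of_le {d μ1 μ2 i j k i' j' k' : ℕ} (h : MinExp d μ1 μ2 i j k)
    (h' : d - (μ1 + μ2) ≤ i' + μ1 * j' + μ2 * k') (hi : i' ≤ i) (hj : j' ≤ j) (hk : k' ≤ k) :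
    i' = i ∧ j' = j ∧ k' = k := by
  obtain ⟨-, h1, h2, h3⟩ := h
  have mj := Nat.mul_le_mul_left μ1 hj
  have mk := Nat.mul_le_mul_left μ2 hk
  refine ⟨?_, ?_, ?_⟩ <;> by_contra hne
  · exact h1 (by omega) (by omega)
  · have := Nat.mul_le_mul_left μ1 (show j' ≤ j - 1 by omega)
    exact h2 (by omega) (by omega)
  · have := Nat.mul_le_mul_left μ2 (show k' ≤ k - 1 by omega)
    exact h3 (by omega) (by omega)

theorem eq_of_psiExp_eq_add {d μ1 μ2 i j k t i' j' k' t' a b m n : ℕ} (hd : μ1 + μ2 ≤ d)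
    (h : MinExp d μ1 μ2 i j k) (ht : t ≤ sval d μ1 μ2 i j k)
    (h' : MinExp d μ1 μ2 i' j' k') (ht' : t' ≤ sval d μ1 μ2 i' j' k')
    (hab : μ1 * m + μ2 * n ≤ a + b)
    (he : psiExp d μ1 μ2 i j k t = expTXY a b m n + psiExp d μ1 μ2 i' j' k' t') :
    i' = i ∧ j' = j ∧ k' = k ∧ t' = t := by
  have e0 := DFunLike.congr_fun he (Sum.inl 0)
  have e1 := DFunLike.congr_fun he (Sum.inl 1)
  have e2 := DFunLike.congr_fun he (Sum.inr 0)
  have e3 := DFunLike.congr_fun he (Sum.inr 1)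
  simp only [psiExp, Finsupp.add_apply, expTXY_inl_zero, expTXY_inl_one, expTXY_inr_zero,
    expTXY_inr_one] at e0 e1 e2 e3
  have hs := sval_add hd h.1
  have hs' := sval_add hd h'.1
  have hi : i' ≤ i := by
    generalize sval d μ1 μ2 i j k = s at *
    rw [e2, e3, mul_add, mul_add] at hs
    omega
  obtain ⟨rfl, rfl, rfl⟩ := h.eq_of_le h'.1 hi (by omega) (by omega)
  refine ⟨rfl, rfl, rfl, ?_⟩
  omega

theorem psi_notMem_span {K : Type} [Field K] {d μ1 μ2 : ℕ} (hd : μ1 + μ2 ≤ d) {q : PTXY K}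
    (hq : q ≠ 0) {S : Set (PBig K μ1 μ2)}
    (hS : ∀ x ∈ S, Phi'Map K μ1 μ2 x = 0 ∨ ∃ i j k t, MinExp d μ1 μ2 i j k ∧
      t ≤ sval d μ1 μ2 i j k ∧ Phi'Map K μ1 μ2 x = monomial (psiExp d μ1 μ2 i j k t) 1 * q)
    {f : PBig K μ1 μ2} {i j k t : ℕ} (hm : MinExp d μ1 μ2 i j k)
    (ht : t ≤ sval d μ1 μ2 i j k)
    (hf : Phi'Map K μ1 μ2 f = monomial (psiExp d μ1 μ2 i j k t) 1 * q)
    (hfS : ∀ x ∈ S, Phi'Map K μ1 μ2 x ≠ Phi'Map K μ1 μ2 f) :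
    f ∉ Ideal.span S := by
  classical
  intro hmem
  have key : ∀ x ∈ Ideal.span S, ∃ h : PTXY K, Phi'Map K μ1 μ2 x = h * q ∧ ∀ e ∈ h.support,
      ∃ i' j' k' t' a b m n, MinExp d μ1 μ2 i' j' k' ∧ t' ≤ sval d μ1 μ2 i' j' k' ∧
        μ1 * m + μ2 * n ≤ a + b ∧ e = expTXY a b m n + psiExp d μ1 μ2 i' j' k' t' ∧
        psiExp d μ1 μ2 i' j' k' t' ≠ psiExp d μ1 μ2 i j k t := by
    intro x hx
    induction hx using Submodule.span_induction with
    | mem x hx =>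
      have hne := hfS x hx
      rcases hS x hx with h0 | ⟨i', j', k', t', hm', ht', h'⟩
      · exact ⟨0, by simpa using h0, by simp⟩
      · refine ⟨_, h', fun e he => ⟨i', j', k', t', 0, 0, 0, 0, hm', ht', le_rfl, ?_, ?_⟩⟩
        · rw [Finset.mem_singleton.mp (support_monomial_subset he)]
          simp [expTXY]
        · intro heq
          exact hne (by rw [h', hf, heq])
    | zero => exact ⟨0, by simp, by simp⟩
    | add x y _ _ hx hy =>
      obtain ⟨g, hg, hg'⟩ := hx
      obtain ⟨h, hh, hh'⟩ := hy
      refine ⟨g + h, by rw [map_add, hg, hh, add_mul], fun e he => ?_⟩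
      exact (Finset.mem_union.mp (support_add he)).elim (hg' e) (hh' e)
    | smul c x _ hx =>
      obtain ⟨g, hg, hg'⟩ := hx
      refine ⟨Phi'Map K μ1 μ2 c * g, by rw [smul_eq_mul, map_mul, hg, mul_assoc], fun e he => ?_⟩
      obtain ⟨u, hu, v, hv, rfl⟩ := Finset.mem_add.mp (support_mul _ _ he)
      obtain ⟨i', j', k', t', a, b, m, n, hm', ht', hc, rfl, hne⟩ := hg' v hv
      refine ⟨i', j', k', t', u (Sum.inl 0) + a, u (Sum.inl 1) + b, u (Sum.inr 0) + m,
        u (Sum.inr 1) + n, hm', ht', ?_, ?_, hne⟩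
      · have := mul_le_of_mem_support_Phi'Map hu
        rw [mul_add, mul_add]
        omega
      · rw [← add_assoc]
        congr 1
        apply exp_ext <;> simp
  obtain ⟨h, hh, hsupp⟩ := key f hmem
  have hmon : h = monomial (psiExp d μ1 μ2 i j k t) 1 := mul_right_cancel₀ hq (hh.symm.trans hf)
  obtain ⟨i', j', k', t', a, b, m, n, hm', ht', hc, he, hne⟩ :=
    hsupp (psiExp d μ1 μ2 i j k t) (by simp [hmon, mem_support_iff])
  obtain ⟨rfl, rfl, rfl, rfl⟩ := eq_of_psiExp_eq_add hd hm ht hm' ht' hc he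
  exact hne rfl

theorem isHomogeneous_add_of_isWeightedHomogeneous {K : Type} [Field K] {μ1 μ2 m n : ℕ}
    {f : PBig K μ1 μ2} (h : f.IsWeightedHomogeneous (wT μ1 μ2) m)
    (h' : f.IsWeightedHomogeneous (wXY μ1 μ2) n) : f.IsHomogeneous (m + n) := by
  intro e he
  rw [← h he, ← h' he]
  simp only [Finsupp.weight_apply, Finsupp.sum_fintype, zero_smul, implies_true, ←
    Finset.sum_add_distrib]
  refine Finset.sum_congr rfl fun v _ => ?_
  rcases v with v | v <;> simp [wT, wXY]

theorem homogeneousComponent_two_mem_span {K σ : Type*} [Field K] {S : Set (MvPolynomial σ K)}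
    (hS : ∀ s ∈ S, ∃ n, 2 ≤ n ∧ s.IsHomogeneous n) {x : MvPolynomial σ K}
    (hx : x ∈ Ideal.span S) : homogeneousComponent 2 x ∈ Submodule.span K S := by
  obtain ⟨N, c, g, rfl⟩ := Submodule.mem_span_set'.mp hx
  rw [map_sum]
  refine Submodule.sum_mem _ fun l _ => ?_
  obtain ⟨n, hn, hg⟩ := hS _ (g l).2
  generalize c l = p
  induction p using MvPolynomial.induction_on' with
  | monomial u a =>
    have hmem : monomial u a • (g l : MvPolynomial σ K) ∈
        homogeneousSubmodule σ K (u.degree + n) := (isHomogeneous_monomial a rfl).mul hg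
    rw [homogeneousComponent_of_mem hmem]
    split_ifs with h
    · have hu : u = 0 := (Finsupp.degree_eq_zero_iff u).mp (by omega)
      rw [hu, ← C_apply, smul_eq_mul, ← smul_eq_C_mul]
      exact Submodule.smul_mem _ _ (Submodule.subset_span (g l).2)
    · exact zero_mem _
  | add p p' hp hp' =>
    rw [add_smul, map_add]
    exact add_mem hp hp'

theorem isHomogeneous_of_mem_genSet {K : Type} [Field K] {μ1 μ2 : ℕ} {g : PBig K μ1 μ2}
    (hg : g ∈ genSet K μ1 μ2) : g.IsHomogeneous 2 := by
  obtain ⟨u, u', v, v', -, -, -, -, -, rfl⟩ := mem_genSet_iff.mp hg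
  exact ((isHomogeneous_X K u').mul (isHomogeneous_X K v)).sub
    ((isHomogeneous_X K u).mul (isHomogeneous_X K v'))

theorem genSet_notMem_span {K : Type} [Field K] {μ1 μ2 : ℕ} {f : PBig K μ1 μ2}
    (hf : f ∈ genSet K μ1 μ2) : f ∉ Submodule.span K (genSet K μ1 μ2 \ {f}) := by
  classical
  obtain ⟨u, u', v, v', h1, h2, h3, h4, h5, rfl⟩ := mem_genSet_iff.mp hf
  let P : Fin 2 ⊕ (Fin (μ1+1) ⊕ Fin (μ2+1)) → Fin 2 ⊕ (Fin (μ1+1) ⊕ Fin (μ2+1)) → Prop :=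
    fun x y => varKind μ1 μ2 x = varKind μ1 μ2 u ∧ varKind μ1 μ2 y = varKind μ1 μ2 v ∧
      varIndex μ1 μ2 x + varIndex μ1 μ2 y = varIndex μ1 μ2 u + varIndex μ1 μ2 v + 1 ∧
      varIndex μ1 μ2 x ≤ varIndex μ1 μ2 u
  let Λ : PBig K μ1 μ2 →ₗ[K] K := (basisMonomials _ K).constr K fun e =>
    if ∃ x y, P x y ∧ e = Finsupp.single x 1 + Finsupp.single y 1 then 1 else 0
  have hΛ : ∀ x y, Λ (X x * X y) = if P x y ∨ P y x then 1 else 0 := by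
    intro x y
    have := (basisMonomials (Fin 2 ⊕ (Fin (μ1+1) ⊕ Fin (μ2+1))) K).constr_basis K (fun e =>
      if ∃ x y, P x y ∧ e = Finsupp.single x 1 + Finsupp.single y 1 then (1 : K) else 0)
      (Finsupp.single x 1 + Finsupp.single y 1)
    rw [X, X, monomial_mul, one_mul]
    rw [coe_basisMonomials] at this
    refine this.trans (if_congr ?_ rfl rfl)
    simp only [Finsupp.single_add_single_eq_single_add_single one_ne_zero one_ne_zero]
    constructor
    · rintro ⟨a, b, hP, ⟨rfl, rfl⟩ | ⟨-, rfl, rfl⟩ | h⟩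
      · exact Or.inl hP
      · exact Or.inr hP
      · exact absurd h.1 (by decide)
    · rintro (h | h)
      · exact ⟨x, y, h, Or.inl ⟨rfl, rfl⟩⟩
      · exact ⟨y, x, h, Or.inr (Or.inl ⟨trivial, rfl, rfl⟩)⟩
  have hker : Submodule.span K (genSet K μ1 μ2 \ {X u' * X v - X u * X v'}) ≤
      LinearMap.ker Λ := by
    rw [Submodule.span_le]
    rintro g ⟨hg, hgf⟩
    obtain ⟨w, w', z, z', k1, k2, k3, k4, k5, rfl⟩ := mem_genSet_iff.mp hg
    have hne : ¬ (varKind μ1 μ2 w = varKind μ1 μ2 u ∧ varIndex μ1 μ2 w = varIndex μ1 μ2 u ∧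
        varKind μ1 μ2 z = varKind μ1 μ2 v ∧ varIndex μ1 μ2 z = varIndex μ1 μ2 v) := by
      rintro ⟨a1, a2, a3, a4⟩
      refine hgf ?_
      rw [Set.mem_singleton_iff, var_ext w u a1 a2, var_ext z v a3 a4,
        var_ext w' u' (by omega) (by omega), var_ext z' v' (by omega) (by omega)]
    rw [SetLike.mem_coe, LinearMap.mem_ker, map_sub, hΛ, hΛ, sub_eq_zero]
    refine if_congr ?_ rfl rfl
    simp only [P]
    omega
  intro hmem
  have h0 := hker hmem
  rw [LinearMap.mem_ker, map_sub, hΛ, hΛ, if_neg, if_pos] at h0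
  · simp at h0
  · exact Or.inl ⟨rfl, h2, by omega, le_rfl⟩
  · simp only [P]
    omega

theorem disjoint_span_ker_Phi'Map {K : Type} [Field K] {d μ1 μ2 : ℕ} {q : PTXY K}
    (hq : q ≠ 0) {S : Set (PBig K μ1 μ2)}
    (hS : ∀ x ∈ S, ∃ i j k t, MinExp d μ1 μ2 i j k ∧
      t ≤ sval d μ1 μ2 i j k ∧ Phi'Map K μ1 μ2 x = monomial (psiExp d μ1 μ2 i j k t) 1 * q)
    (hinj : Set.InjOn (Phi'Map K μ1 μ2) S) :
    Disjoint (Submodule.span K S) (LinearMap.ker (Phi'Map K μ1 μ2).toLinearMap) := by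
  rw [← Subtype.range_coe (s := S)]
  refine Submodule.range_ker_disjoint ?_
  choose i j k t hm ht hx using hS
  let e : S → (Fin 2 ⊕ Fin 2 →₀ ℕ) := fun x =>
    psiExp d μ1 μ2 (i x x.2) (j x x.2) (k x x.2) (t x x.2)
  have he : Function.Injective e := by
    intro x y hxy
    refine Subtype.ext (hinj x.2 y.2 ?_)
    rw [hx x x.2, hx y y.2]
    exact congrArg (fun e => monomial e (1 : K) * q) hxy
  have h1 := ((basisMonomials (Fin 2 ⊕ Fin 2) K).linearIndependent.comp e he).map'
    (LinearMap.mulRight K q) (LinearMap.ker_eq_bot.mpr (mul_left_injective₀ hq))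
  convert! h1 using 1
  ext1 x
  simp only [Function.comp_apply, AlgHom.toLinearMap_apply, hx x x.2, coe_basisMonomials,
    LinearMap.mulRight_apply, e]

theorem syz_ne_zero {K : Type} [Field K] {α : PT K} (hα : α ≠ 0) (β : PT K) : syz α β ≠ 0 := by
  intro h
  have := congrArg (aeval (Sum.elim X ![(0 : PT K), 1])) h
  simp [syz, bind₁_rename] at this
  exact hα this

theorem pos_of_mem_genSet {K : Type} [Field K] {μ1 μ2 : ℕ} {g : PBig K μ1 μ2}
    (hg : g ∈ genSet K μ1 μ2) : 0 < μ1 + μ2 := by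
  rcases hg with (((⟨i, h1, h2, -⟩ | ⟨i, h1, h2, -⟩) | ⟨i, j, h1, h2, h3, -⟩) |
    ⟨i, j, h1, h2, h3, -⟩) | ⟨i, j, h1, h2, h3, -⟩ <;> omega

theorem stmt7 (K : Type) [Field K] (d μ1 μ2 : ℕ) (hμ12 : μ1 ≤ μ2)
    (hd : 2 * (μ1 + μ2) ≤ d)
    (α β : PT K) (hα0 : α ≠ 0) (hβ0 : β ≠ 0)
    (hα : α.IsHomogeneous (d - μ1)) (hβ : β.IsHomogeneous (d - μ2))
    (hcop : ∀ c : PT K, c ∣ α → c ∣ β → IsUnit c)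
    (Ψ : ℕ → ℕ → ℕ → ℕ → PBig K μ1 μ2)
    (hΨ : ∀ i j k t : ℕ, MinExp d μ1 μ2 i j k → t ≤ sval d μ1 μ2 i j k →
      (Ψ i j k t).IsWeightedHomogeneous (wT μ1 μ2) i ∧
      (Ψ i j k t).IsWeightedHomogeneous (wXY μ1 μ2) (j + k + 1) ∧
      Phi'Map K μ1 μ2 (Ψ i j k t) =
        X (Sum.inl 0) ^ t * X (Sum.inl 1) ^ (sval d μ1 μ2 i j k - t) *
          X (Sum.inr 0) ^ j * X (Sum.inr 1) ^ k *
          ((rename Sum.inl α : PTXY K) * X (Sum.inr 1)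
            - (rename Sum.inl β : PTXY K) * X (Sum.inr 0))) :
    RingHom.ker (PhiMap K μ1 μ2 α β) =
      Ideal.span (genSet K μ1 μ2 ∪
        {f | ∃ i j k t : ℕ, MinExp d μ1 μ2 i j k ∧ t ≤ sval d μ1 μ2 i j k ∧
          f = Ψ i j k t}) ∧
    ∀ f ∈ genSet K μ1 μ2 ∪
        {f | ∃ i j k t : ℕ, MinExp d μ1 μ2 i j k ∧ t ≤ sval d μ1 μ2 i j k ∧
          f = Ψ i j k t},
      f ∉ Ideal.span ((genSet K μ1 μ2 ∪
        {f | ∃ i j k t : ℕ, MinExp d μ1 μ2 i j k ∧ t ≤ sval d μ1 μ2 i j k ∧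
          f = Ψ i j k t}) \ {f}) := by
  set P : Set (PBig K μ1 μ2) := {f | ∃ i j k t : ℕ, MinExp d μ1 μ2 i j k ∧
    t ≤ sval d μ1 μ2 i j k ∧ f = Ψ i j k t} with hP
  have hd' : μ1 + μ2 ≤ d := by omega
  have hΨ' : ∀ i j k t, MinExp d μ1 μ2 i j k → t ≤ sval d μ1 μ2 i j k →
      Phi'Map K μ1 μ2 (Ψ i j k t) = monomial (psiExp d μ1 μ2 i j k t) 1 * syz α β := by
    intro i j k t hm ht
    rw [(hΨ i j k t hm ht).2.2, psiExp, monomial_expTXY, syz]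
  have hq : syz α β ≠ 0 := syz_ne_zero hα0 β
  have hsyz := PhiMap_eq_zero_iff (μ1 := μ1) (μ2 := μ2) hα0 (fun _ h h' => hcop _ h h')
  have hPS : ∀ x ∈ P, ∃ i j k t, MinExp d μ1 μ2 i j k ∧ t ≤ sval d μ1 μ2 i j k ∧
      Phi'Map K μ1 μ2 x = monomial (psiExp d μ1 μ2 i j k t) 1 * syz α β := by
    rintro _ ⟨i, j, k, t, hm, ht, rfl⟩
    exact ⟨i, j, k, t, hm, ht, hΨ' i j k t hm ht⟩
  have hinj : Set.InjOn (Phi'Map K μ1 μ2) P := by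
    rintro _ ⟨i, j, k, t, hm, ht, rfl⟩ _ ⟨i', j', k', t', hm', ht', rfl⟩ h
    rw [hΨ' i j k t hm ht, hΨ' i' j' k' t' hm' ht'] at h
    have he := monomial_left_injective (one_ne_zero (α := K)) (mul_right_cancel₀ hq h)
    obtain ⟨rfl, rfl, rfl, rfl⟩ := eq_of_psiExp_eq_add (a := 0) (b := 0) (m := 0) (n := 0)
      hd' hm ht hm' ht' le_rfl (by simpa [expTXY] using he)
    rfl
  refine ⟨le_antisymm ?_ ?_, ?_⟩
  · intro f hf
    obtain ⟨g, hg⟩ := (hsyz f).mp hf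
    rw [mul_comm] at hg
    obtain ⟨x, hx, hxg⟩ := exists_mem_Phi'Map_eq (J := Ideal.span (genSet K μ1 μ2 ∪ P)) hd'
      (fun i j k t hm ht => ⟨Ψ i j k t,
        Ideal.subset_span (Or.inr ⟨i, j, k, t, hm, ht, rfl⟩), hΨ' i j k t hm ht⟩)
      (weight_of_mem_support_of_mul hq
        (fun e he => weight_of_mem_support_syz hd' hα hβ he)
        (fun e he => mul_le_of_mem_support_Phi'Map (f := f) (hg ▸ he)))
    have hfx : f - x ∈ Ideal.span (genSet K μ1 μ2) :=
      Phi'Map_ker (by rw [map_sub, hg, hxg, sub_self])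
    have := Ideal.add_mem _ (Ideal.span_mono Set.subset_union_left hfx) hx
    rwa [sub_add_cancel] at this
  · rw [Ideal.span_le]
    rintro x (hx | hx)
    · exact (hsyz x).mpr (by rw [Phi'Map_eq_zero_of_mem_genSet hx]; exact dvd_zero _)
    · obtain ⟨i, j, k, t, -, -, h⟩ := hPS x hx
      exact (hsyz x).mpr (by rw [h]; exact dvd_mul_left _ _)
  · rintro f (hf | hf) hmem
    · have hpos := pos_of_mem_genSet hf
      have h2 := homogeneousComponent_two_mem_span (S := (genSet K μ1 μ2 ∪ P) \ {f}) (by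
        rintro s ⟨hs | ⟨i, j, k, t, hm, ht, rfl⟩, -⟩
        · exact ⟨2, le_rfl, isHomogeneous_of_mem_genSet hs⟩
        · obtain ⟨h1, h2, -⟩ := hΨ i j k t hm ht
          refine ⟨_, ?_, isHomogeneous_add_of_isWeightedHomogeneous h1 h2⟩
          by_contra hlt
          obtain ⟨rfl, rfl, rfl⟩ : i = 0 ∧ j = 0 ∧ k = 0 := by omega
          have := hm.1
          omega) hmem
      rw [homogeneousComponent_eq_self (isHomogeneous_of_mem_genSet hf), Set.union_sdiff_distrib,
        Submodule.span_union] at h2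
      obtain ⟨a, ha, b, hb, rfl⟩ := Submodule.mem_sup.mp h2
      have hb' : b ∈ Submodule.span K P := Submodule.span_mono Set.sdiff_subset hb
      have ha' : Phi'Map K μ1 μ2 a = 0 := by
        refine (Submodule.span_le (p := LinearMap.ker (Phi'Map K μ1 μ2).toLinearMap)).mpr ?_ ha
        exact fun x hx => Phi'Map_eq_zero_of_mem_genSet hx.1
      have hbk : Phi'Map K μ1 μ2 b = 0 := by
        have := Phi'Map_eq_zero_of_mem_genSet hf
        rwa [map_add, ha', zero_add] at this
      have hb0 : b = 0 :=
        Submodule.disjoint_def.mp (disjoint_span_ker_Phi'Map hq hPS hinj) b hb' hbk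
      rw [hb0, add_zero] at ha hf
      exact genSet_notMem_span hf ha
    · obtain ⟨i, j, k, t, hm, ht, hfΨ⟩ := hf
      refine psi_notMem_span hd' hq ?_ hm ht (hfΨ ▸ hΨ' i j k t hm ht) ?_ hmem
      · rintro x ⟨hx | hx, -⟩
        · exact Or.inl (Phi'Map_eq_zero_of_mem_genSet hx)
        · exact Or.inr (hPS x hx)
      · rintro x ⟨hx | hx, hxf⟩ heq
        · rw [Phi'Map_eq_zero_of_mem_genSet hx, hfΨ, hΨ' i j k t hm ht] at heq
          exact mul_ne_zero (by simp) hq heq.symm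
        · exact hxf (hinj hx ⟨i, j, k, t, hm, ht, hfΨ⟩ heq)
end
end

section
/- Suppose q = (q_0,q_1,q_2) ∈ K[T0,T1]³ satisfies f = p × q componentwise (i.e., f_0 = p_1q_2 − p_2q_1, f_1 = p_2q_0 − p_0q_2, f_2 = p_0q_1 − p_1q_0), where p = A × B ≠ (0,0,0) and f_i = α·A_i + β·B_i. Then α = −(q_0·B_0 + q_1·B_1 + q_2·B_2) and β = q_0·A_0 + q_1·A_1 + q_2·A_2; consequently Ω(q_0·Z_0 + q_1·Z_1 + q_2·Z_2) = −(α·Y − β·X). -/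
open MvPolynomial

noncomputable section

/-- The polynomial ring `K[T0,T1,Z_0,Z_1,Z_2]`. -/
abbrev PTZ (K : Type) [Field K] := MvPolynomial (Fin 2 ⊕ Fin 3) K

/-- The map `Ω : K[T0,T1,Z_0,Z_1,Z_2] → K[T0,T1,X,Y]` with `Z_i ↦ A_i·X + B_i·Y`. -/
def OmegaMap (K : Type) [Field K] (A B : Fin 3 → PT K) : PTZ K →ₐ[K] PTXY K :=
  aeval (Sum.elim (fun i => X (Sum.inl i))
    (fun i => rename Sum.inl (A i) * X (Sum.inr 0) + rename Sum.inl (B i) * X (Sum.inr 1)))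

/-- The cross product of two triples of polynomials. -/
def crossProd (K : Type) [Field K] (A B : Fin 3 → PT K) : Fin 3 → PT K :=
  ![A 1 * B 2 - A 2 * B 1, A 2 * B 0 - A 0 * B 2, A 0 * B 1 - A 1 * B 0]

/-- If `a • A + b • B = 0` and `A × B ≠ 0`, then both coefficients vanish. -/
theorem eq_zero_of_crossProd_ne_zero (K : Type) [Field K] (A B : Fin 3 → PT K)
    (hp : ¬ ∀ i, crossProd K A B i = 0) (a b : PT K)
    (h : ∀ i, a * A i + b * B i = 0) : a = 0 ∧ b = 0 := by
  obtain ⟨i, hi⟩ := not_forall.mp hp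
  have ha : a * crossProd K A B i = 0 := by
    fin_cases i <;>
      simp only [crossProd, Fin.zero_eta, Fin.mk_one, Fin.reduceFinMk, Matrix.cons_val]
    · linear_combination B 2 * h 1 - B 1 * h 2
    · linear_combination B 0 * h 2 - B 2 * h 0
    · linear_combination B 1 * h 0 - B 0 * h 1
  have hb : b * crossProd K A B i = 0 := by
    fin_cases i <;>
      simp only [crossProd, Fin.zero_eta, Fin.mk_one, Fin.reduceFinMk, Matrix.cons_val]
    · linear_combination A 1 * h 2 - A 2 * h 1
    · linear_combination A 2 * h 0 - A 0 * h 2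
    · linear_combination A 0 * h 1 - A 1 * h 0
  exact ⟨(mul_eq_zero.mp ha).resolve_right hi, (mul_eq_zero.mp hb).resolve_right hi⟩

/-- The map `Ω` fixes `K[T0,T1]`. -/
theorem OmegaMap_rename_inl (K : Type) [Field K] (A B : Fin 3 → PT K) (g : PT K) :
    OmegaMap K A B (rename Sum.inl g) = rename Sum.inl g := by
  have h : (OmegaMap K A B).comp (rename Sum.inl) = rename Sum.inl :=
    algHom_ext fun i => by simp [OmegaMap]
  exact DFunLike.congr_fun h g

theorem stmt12 (K : Type) [Field K] (d μ1 μ2 : ℕ) (hμ12 : μ1 ≤ μ2)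
    (hd : 2 * (μ1 + μ2) ≤ d)
    (α β : PT K) (hα0 : α ≠ 0) (hβ0 : β ≠ 0)
    (hα : α.IsHomogeneous (d - μ1)) (hβ : β.IsHomogeneous (d - μ2))
    (hcop : ∀ c : PT K, c ∣ α → c ∣ β → IsUnit c)
    (A B : Fin 3 → PT K)
    (hAhom : ∀ i, (A i).IsHomogeneous μ1) (hBhom : ∀ i, (B i).IsHomogeneous μ2)
    (hp0 : ¬ (∀ i, crossProd K A B i = 0))
    (f : Fin 3 → PT K) (hf : ∀ i, f i = α * A i + β * B i)
    (q : Fin 3 → PT K)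
    (hfq : ∀ i, f i = crossProd K (crossProd K A B) q i) :
    α = -(q 0 * B 0 + q 1 * B 1 + q 2 * B 2) ∧
    β = q 0 * A 0 + q 1 * A 1 + q 2 * A 2 ∧
    OmegaMap K A B (∑ i : Fin 3, (rename Sum.inl (q i) : PTZ K) * X (Sum.inr i)) =
      -((rename Sum.inl α : PTXY K) * X (Sum.inr 1)
        - (rename Sum.inl β : PTXY K) * X (Sum.inr 0)) := by
  have key := eq_zero_of_crossProd_ne_zero K A B hp0
    (α + (q 0 * B 0 + q 1 * B 1 + q 2 * B 2)) (β - (q 0 * A 0 + q 1 * A 1 + q 2 * A 2)) <| by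
      intro i
      have h := (hf i).symm.trans (hfq i)
      fin_cases i <;>
        simp only [crossProd, Fin.zero_eta, Fin.mk_one, Fin.reduceFinMk, Matrix.cons_val] at h ⊢ <;>
        linear_combination h
  have hα' : α = -(q 0 * B 0 + q 1 * B 1 + q 2 * B 2) := eq_neg_of_add_eq_zero_left key.1
  have hβ' : β = q 0 * A 0 + q 1 * A 1 + q 2 * A 2 := sub_eq_zero.mp key.2
  refine ⟨hα', hβ', ?_⟩
  have hZ (i : Fin 3) : OmegaMap K A B (X (Sum.inr i)) =
      rename Sum.inl (A i) * X (Sum.inr 0) + rename Sum.inl (B i) * X (Sum.inr 1) := by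
    simp [OmegaMap]
  rw [hα', hβ']
  simp only [Fin.sum_univ_three, map_add, map_mul, map_neg, OmegaMap_rename_inl, hZ]
  ring
end
end
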